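/- If k ≥ 2, t₁ ≥ 1 and t_k ≥ 1 (and t₂, …, t_{k−1} ≥ 0), then gpg'(T_{t₁,…,t_k}) = min over i ∈ [k] of max{ t₁ + ⋯ + t_{i−1}, t_{i+1} + ⋯ + t_k } + 1. -/

import Mathlib

open Finset SimpleGraph

variable {V : Type*}

/-- `S` is in general position in `G`: no shortest path of `G` contains more than
two vertices of `S`. -/
def IsGPSet (G : SimpleGraph V) (S : Set V) : Prop :=
  ∀ ⦃u v : V⦄ (p : G.Walk u v), p.IsPath → p.length = G.dist u v →
    (S ∩ {x | x ∈ p.support}).ncard ≤ 2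

open scoped Classical in
/-- The set of vertices that can legally be played when the set of already selected
vertices is `S`. -/
noncomputable def playable [Fintype V] (G : SimpleGraph V) (S : Finset V) : Finset V :=
  Finset.univ.filter (fun v => v ∉ S ∧ IsGPSet G (↑(insert v S) : Set V))

open scoped Classical in
/-- Value (final set size with optimal play) of the Builder-Blocker general position game
from position `S` with the given player to move (`true` = Builder, the maximiser;
`false` = Blocker, the minimiser), computed with a fuel parameter. -/
noncomputable def gameValAux [Fintype V] (G : SimpleGraph V) : ℕ → Bool → Finset V → ℕ
  | 0, _, S => S.card
  | fuel + 1, turn, S =>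
    if h : (playable G S).Nonempty then
      if turn then (playable G S).sup' h (fun v => gameValAux G fuel (!turn) (insert v S))
      else (playable G S).inf' h (fun v => gameValAux G fuel (!turn) (insert v S))
    else S.card

/-- Value of the Builder-Blocker general position game from position `S`,
with `turn = true` meaning Builder (the maximiser) is to move. Since at most
`Fintype.card V - S.card` further moves are possible, this fuel suffices. -/
noncomputable def gameVal [Fintype V] (G : SimpleGraph V) (turn : Bool) (S : Finset V) : ℕ :=
  gameValAux G (Fintype.card V - S.card) turn S

/-- The B-game general position number: Builder moves first. -/
noncomputable def gpg [Fintype V] (G : SimpleGraph V) : ℕ := gameVal G true ∅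

/-- The B'-game general position number: Blocker moves first. -/
noncomputable def gpg' [Fintype V] (G : SimpleGraph V) : ℕ := gameVal G false ∅

/-- Base relation for the tree `T_{t₁,…,t_k}`: the central path `u₁, …, u_k`
(encoded as `Sum.inl i`) with `t i` pendant leaves attached to `u_i`
(encoded as `Sum.inr ⟨i, j⟩`). -/
def TmodelRel (k : ℕ) (t : Fin k → ℕ) :
    (Fin k ⊕ Σ i : Fin k, Fin (t i)) → (Fin k ⊕ Σ i : Fin k, Fin (t i)) → Prop
  | Sum.inl i, Sum.inl i' => (i' : ℕ) = (i : ℕ) + 1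
  | Sum.inl i, Sum.inr ⟨i', _⟩ => i = i'
  | _, _ => False

/-- The tree `T_{t₁,…,t_k}`: a path `u₁, …, u_k` with `t i` leaves attached to `u_i`. -/
def Tmodel (k : ℕ) (t : Fin k → ℕ) : SimpleGraph (Fin k ⊕ Σ i : Fin k, Fin (t i)) :=
  SimpleGraph.fromRel (TmodelRel k t)

section GeneralPosition

variable {G : SimpleGraph V}

/-- Along a geodesic the distances between vertices agree with the index differences. -/
lemma dist_getVert_of_length_eq_dist (hG : G.Connected) {u v : V} (p : G.Walk u v)
    (hp : p.length = G.dist u v) {i j : ℕ} (hij : i ≤ j) (hj : j ≤ p.length) :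
    G.dist (p.getVert i) (p.getVert j) = j - i := by
  have key : ∀ {a b : V} (q : G.Walk a b) (n : ℕ), n ≤ q.length →
      G.dist a (q.getVert n) ≤ n ∧ G.dist (q.getVert n) b ≤ q.length - n := by
    intro a b q n hn
    refine ⟨(dist_le (q.take n)).trans ?_, (dist_le (q.drop n)).trans ?_⟩
    · simp
    · simp
  have h1 := (key p i (hij.trans hj)).1
  have h2 := (key p j hj).2
  have h3 : G.dist (p.getVert i) (p.getVert j) ≤ j - i := by
    have := (key (p.drop i) (j - i) (by simp; omega)).1
    rwa [Walk.drop_getVert, Nat.add_sub_cancel' hij] at this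
  have h4 := hG.dist_triangle (u := u) (v := p.getVert i) (w := v)
  have h5 := hG.dist_triangle (u := p.getVert i) (v := p.getVert j) (w := v)
  omega

/-- In a connected graph, general position means that no vertex of the set is metrically
between two others. -/
lemma isGPSet_iff_dist [Finite V] (hG : G.Connected) (S : Set V) :
    IsGPSet G S ↔ ∀ a ∈ S, ∀ m ∈ S, ∀ b ∈ S, a ≠ m → m ≠ b → a ≠ b →
      G.dist a m + G.dist m b ≠ G.dist a b := by
  constructor
  · intro h a ha m hm b hb ham hmb hab hd
    obtain ⟨p, hp⟩ := hG.exists_walk_length_eq_dist a m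
    obtain ⟨q, hq⟩ := hG.exists_walk_length_eq_dist m b
    have hl : (p.append q).length = G.dist a b := by
      rw [Walk.length_append, hp, hq, hd]
    have h2 := h (p.append q) (Walk.isPath_of_length_eq_dist _ hl) hl
    refine absurd h2 (not_le.2 ?_)
    rw [Set.two_lt_ncard_iff (Set.toFinite _)]
    exact ⟨a, m, b, ⟨ha, by simp⟩, ⟨hm, by simp⟩, ⟨hb, by simp⟩, ham, hab, hmb⟩
  · intro h u v p _ hl
    by_contra hc
    rw [not_le, Set.two_lt_ncard_iff (Set.toFinite _)] at hc
    obtain ⟨a, b, c, ⟨ha, ha'⟩, ⟨hb, hb'⟩, ⟨hc, hc'⟩, hab, hac, hbc⟩ := hc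
    have key : ∀ i j l : ℕ, i < j → j < l → l ≤ p.length → p.getVert i ∈ S →
        p.getVert j ∈ S → p.getVert l ∈ S → False := by
      intro i j l hij hjl hlp hi hj hl'
      have d1 := dist_getVert_of_length_eq_dist hG p hl hij.le (hjl.le.trans hlp)
      have d2 := dist_getVert_of_length_eq_dist hG p hl hjl.le hlp
      have d3 := dist_getVert_of_length_eq_dist hG p hl (hij.trans hjl).le hlp
      have ne : ∀ {x y : V}, 0 < G.dist x y → x ≠ y := by
        rintro x y hxy rfl
        simp at hxy
      exact h _ hi _ hj _ hl' (ne (by omega)) (ne (by omega)) (ne (by omega)) (by omega)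
    simp only [Set.mem_ofPred_eq, Walk.mem_support_iff_exists_getVert] at ha' hb' hc'
    obtain ⟨i, rfl, hi⟩ := ha'
    obtain ⟨j, rfl, hj⟩ := hb'
    obtain ⟨l, rfl, hl'⟩ := hc'
    have hij : i ≠ j := fun e => hab (e ▸ rfl)
    have hil : i ≠ l := fun e => hac (e ▸ rfl)
    have hjl : j ≠ l := fun e => hbc (e ▸ rfl)
    rcases lt_or_gt_of_ne hij with h1 | h1 <;> rcases lt_or_gt_of_ne hil with h2 | h2 <;>
      rcases lt_or_gt_of_ne hjl with h3 | h3
    all_goals first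
      | omega
      | exact key i j l (by omega) (by omega) (by omega) ‹_› ‹_› ‹_›
      | exact key i l j (by omega) (by omega) (by omega) ‹_› ‹_› ‹_›
      | exact key j i l (by omega) (by omega) (by omega) ‹_› ‹_› ‹_›
      | exact key j l i (by omega) (by omega) (by omega) ‹_› ‹_› ‹_›
      | exact key l i j (by omega) (by omega) (by omega) ‹_› ‹_› ‹_›
      | exact key l j i (by omega) (by omega) (by omega) ‹_› ‹_› ‹_›

lemma isGPSet_of_ncard_le_two [Finite V] {S : Set V} (hS : S.ncard ≤ 2) : IsGPSet G S :=
  fun _ _ _ _ _ => (Set.ncard_le_ncard Set.inter_subset_left (Set.toFinite _)).trans hS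

end GeneralPosition

section Game

variable [Fintype V] {G : SimpleGraph V}

lemma mem_playable {S : Finset V} {v : V} :
    v ∈ playable G S ↔ v ∉ S ∧ IsGPSet G (insert v (S : Set V)) := by
  classical
  simp [playable]

lemma gameValAux_le {S₀ : Finset V} {B : ℕ}
    (h : ∀ S : Finset V, S₀ ⊆ S → IsGPSet G (S : Set V) → S.card ≤ B) (n : ℕ) :
    ∀ (turn : Bool) (S : Finset V), S₀ ⊆ S → IsGPSet G (S : Set V) →
      gameValAux G n turn S ≤ B := by
  classical
  induction n with
  | zero => exact fun _ S hS hgp => h S hS hgp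
  | succ n ih =>
    intro turn S hS hgp
    have step : ∀ v ∈ playable G S, ∀ b, gameValAux G n b (insert v S) ≤ B := fun v hv b => by
      convert ih b (insert v S) (hS.trans (Finset.subset_insert _ _))
        (by simpa using (mem_playable.1 hv).2)
    rw [gameValAux]
    split_ifs with hne ht
    · exact Finset.sup'_le _ _ fun v hv => by convert step v hv _
    · obtain ⟨v, hv⟩ := hne
      refine (Finset.inf'_le _ hv).trans ?_
      convert step v hv _
    · exact h S hS hgp

lemma le_gameValAux {S₀ : Finset V} {B : ℕ}
    (h : ∀ S : Finset V, S₀ ⊆ S → IsGPSet G (S : Set V) →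
      (∀ v ∉ S, ¬ IsGPSet G (insert v (S : Set V))) → B ≤ S.card) (n : ℕ) :
    ∀ (turn : Bool) (S : Finset V), S₀ ⊆ S → IsGPSet G (S : Set V) →
      Fintype.card V ≤ S.card + n → B ≤ gameValAux G n turn S := by
  classical
  induction n with
  | zero =>
    intro _ S hS hgp hc
    have hu : S = Finset.univ := Finset.eq_univ_of_card S
      (le_antisymm (Finset.card_le_univ S) (by simpa using hc))
    exact h S hS hgp fun v hv => absurd (hu ▸ Finset.mem_univ v) hv
  | succ n ih =>
    intro turn S hS hgp hc
    have step : ∀ v ∈ playable G S, ∀ b, B ≤ gameValAux G n b (insert v S) := fun v hv b => by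
      refine ih b (insert v S) (hS.trans (Finset.subset_insert _ _))
        (by simpa using (mem_playable.1 hv).2) ?_
      rw [Finset.card_insert_of_notMem (mem_playable.1 hv).1]
      omega
    rw [gameValAux]
    split_ifs with hne ht
    · obtain ⟨v, hv⟩ := hne
      refine le_trans ?_ (Finset.le_sup' _ hv)
      convert step v hv _
    · exact Finset.le_inf' _ _ fun v hv => by convert step v hv _
    · refine h S hS hgp fun v hv hgp' => hne ⟨v, mem_playable.2 ⟨hv, hgp'⟩⟩

/-- Blocker can open with `x`, so `gpg'` is at most the largest general position set
containing `x`. -/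
lemma gpg'_le {B : ℕ} (x : V)
    (h : ∀ S : Finset V, x ∈ S → IsGPSet G (S : Set V) → S.card ≤ B) : gpg' G ≤ B := by
  classical
  obtain ⟨n, hn⟩ : ∃ n, Fintype.card V = n + 1 :=
    Nat.exists_eq_succ_of_ne_zero (Fintype.card_pos_iff.2 ⟨x⟩).ne'
  have hgp : IsGPSet G ({x} : Set V) := isGPSet_of_ncard_le_two (by simp)
  have hx : x ∈ playable G ∅ := mem_playable.2 ⟨by simp, by simpa using hgp⟩
  rw [gpg', gameVal, Finset.card_empty, Nat.sub_zero, hn, gameValAux, dif_pos ⟨x, hx⟩,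
    if_neg (by simp)]
  refine (Finset.inf'_le _ hx).trans
    (gameValAux_le (S₀ := {x}) (fun S hS => h S (by simpa using hS)) _ _ _ (by simp) ?_)
  simpa using hgp

/-- Builder can answer each opening move `x` with `y`, so `gpg'` is at least the smallest
maximal general position set containing such a pair. -/
lemma le_gpg' [Nontrivial V] {B : ℕ}
    (h : ∀ x : V, ∃ y, y ≠ x ∧ ∀ S : Finset V, x ∈ S → y ∈ S → IsGPSet G (S : Set V) →
      (∀ v ∉ S, ¬ IsGPSet G (insert v (S : Set V))) → B ≤ S.card) : B ≤ gpg' G := by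
  classical
  obtain ⟨n, hn⟩ : ∃ n, Fintype.card V = n + 1 + 1 :=
    ⟨Fintype.card V - 2, by have := Fintype.one_lt_card (α := V); omega⟩
  have hx : ∀ x : V, x ∈ playable G ∅ := fun x =>
    mem_playable.2 ⟨by simp, isGPSet_of_ncard_le_two (by simp)⟩
  have hne : (playable G ∅).Nonempty := ⟨Classical.arbitrary V, hx _⟩
  rw [gpg', gameVal, Finset.card_empty, Nat.sub_zero, hn, gameValAux, dif_pos hne,
    if_neg (by simp)]
  refine Finset.le_inf' _ _ fun x _ => ?_
  obtain ⟨y, hyx, hy⟩ := h x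
  have hgp : IsGPSet G ({y, x} : Set V) := isGPSet_of_ncard_le_two (Set.ncard_pair hyx).le
  have hyp : y ∈ playable G {x} := mem_playable.2 ⟨by simpa using hyx, by simpa using hgp⟩
  have hins : insert x (∅ : Finset V) = {x} := by simp
  rw [show (insert x ∅ : Finset V) = {x} by convert hins, gameValAux, dif_pos ⟨y, hyp⟩,
    if_pos (by simp)]
  refine le_trans ?_ (Finset.le_sup' _ hyp)
  refine le_gameValAux (S₀ := {y, x}) (fun S hS => hy S (hS (by simp)) (hS (by simp)))
    _ _ _ ?_ ?_ ?_
  · intro v; simp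
  · simpa using hgp
  · rw [Finset.card_insert_of_notMem (by simpa using hyx), Finset.card_singleton]
    omega

end Game

section Caterpillar

variable {α : Type*} {t : α → ℕ}

/-- The index of the central path vertex nearest to a vertex of the caterpillar. -/
def spineIndex : (α ⊕ Σ i : α, Fin (t i)) → α :=
  Sum.elim id Sigma.fst

@[simp] lemma spineIndex_inl (i : α) :
    spineIndex (Sum.inl i : α ⊕ Σ i : α, Fin (t i)) = i := rfl

@[simp] lemma spineIndex_inr (a : Σ i : α, Fin (t i)) :
    spineIndex (Sum.inr a : α ⊕ Σ i : α, Fin (t i)) = a.1 := rfl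

variable [LinearOrder α]

/-- No central path vertex of `S` lies between two further vertices of `S`. -/
def SpineFree (S : Set (α ⊕ Σ i : α, Fin (t i))) : Prop :=
  ∀ l, Sum.inl l ∈ S → ∀ a ∈ S, ∀ b ∈ S, a ≠ Sum.inl l → b ≠ Sum.inl l → a ≠ b →
    spineIndex a ≤ l → l ≤ spineIndex b → False

lemma SpineFree.dual {S : Set (α ⊕ Σ i : α, Fin (t i))} (hS : SpineFree S) :
    SpineFree (α := αᵒᵈ) (t := t) S :=
  fun l hl a ha b hb hal hbl hab h1 h2 => hS l hl b hb a ha hbl hal hab.symm h2 h1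

variable [Fintype α]

/-- The leaves attached to the left of `i`. -/
def leavesLeft (t : α → ℕ) (i : α) : Finset (α ⊕ Σ i : α, Fin (t i)) :=
  ((Finset.univ.filter (· < i)).sigma fun j => (Finset.univ : Finset (Fin (t j)))).map
    Function.Embedding.inr

lemma card_leavesLeft (i : α) :
    (leavesLeft t i).card = ∑ j ∈ Finset.univ.filter (· < i), t j := by
  simp [leavesLeft]

lemma inr_mem_leavesLeft {i : α} {a : Σ i : α, Fin (t i)} :
    Sum.inr a ∈ leavesLeft t i ↔ a.1 < i := by
  simp [leavesLeft]

lemma inl_notMem_leavesLeft {i l : α} : Sum.inl l ∉ leavesLeft t i := by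
  simp [leavesLeft]

lemma card_le_of_left {S : Finset (α ⊕ Σ i : α, Fin (t i))}
    (hS : SpineFree (S : Set (α ⊕ Σ i : α, Fin (t i)))) {c i : α} (hc : ∀ j, c ≤ j)
    (htc : 1 ≤ t c) (hi : Sum.inl i ∈ S) {a : α ⊕ Σ i : α, Fin (t i)} (ha : a ∈ S)
    (hai : spineIndex a < i) :
    S.card ≤ (∑ j ∈ Finset.univ.filter (· < i), t j) + 1 := by
  classical
  rw [← card_leavesLeft, ← Finset.card_erase_add_one hi, Nat.add_le_add_iff_right]
  have hane : a ≠ Sum.inl i := by rintro rfl; simp at hai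
  have hlt : ∀ b ∈ S, b ≠ Sum.inl i → spineIndex b < i := by
    intro b hb hbi
    by_contra hle
    exact hS i hi a ha b hb hane hbi (by rintro rfl; exact hle hai) hai.le (not_lt.1 hle)
  by_cases hl : ∃ l, l ≠ i ∧ Sum.inl l ∈ S
  · obtain ⟨l, hli, hl⟩ := hl
    have hlti : l < i := hlt _ hl (by simpa using hli)
    let y : α ⊕ Σ i : α, Fin (t i) := Sum.inr ⟨c, ⟨0, htc⟩⟩
    have hy : y ∈ leavesLeft t i := inr_mem_leavesLeft.2 ((hc l).trans_lt hlti)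
    have hyS : y ∉ S := fun hy' =>
      hS l hl y hy' _ hi (by simp [y]) (by simpa using hli.symm) (by simp [y]) (hc l) hlti.le
    rw [← Finset.card_erase_add_one hy,
      ← Finset.card_erase_add_one (Finset.mem_erase.2 ⟨by simpa using hli, hl⟩),
      Nat.add_le_add_iff_right]
    refine Finset.card_le_card fun b hb => ?_
    simp only [Finset.mem_erase] at hb ⊢
    obtain ⟨hbl, hbi, hb⟩ := hb
    refine ⟨by rintro rfl; exact hyS hb, ?_⟩
    rcases b with m | b
    · exfalso
      have hmi : m < i := hlt _ hb hbi
      rcases le_total m l with h | h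
      · exact hS l hl _ hb _ hi hbl (by simpa using hli.symm) hbi h hlti.le
      · exact hS m hb _ hl _ hi hbl.symm (by simpa using hmi.ne') (by simpa using hli) h hmi.le
    · exact inr_mem_leavesLeft.2 (hlt _ hb hbi)
  · refine Finset.card_le_card fun b hb => ?_
    obtain ⟨hbi, hb⟩ := Finset.mem_erase.1 hb
    rcases b with m | b
    · exact absurd ⟨m, by simpa using hbi, hb⟩ hl
    · exact inr_mem_leavesLeft.2 (hlt _ hb hbi)

lemma card_ge_of_maximal {S : Finset (α ⊕ Σ i : α, Fin (t i))}
    (hS : SpineFree (S : Set (α ⊕ Σ i : α, Fin (t i))))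
    (hmax : ∀ v ∉ S, ¬ SpineFree (insert v (S : Set (α ⊕ Σ i : α, Fin (t i)))))
    {c : α} (hc : ∀ j, c ≤ j) (s : Fin (t c)) {x : α ⊕ Σ i : α, Fin (t i)} (hx : x ∈ S)
    (hy : Sum.inr ⟨c, s⟩ ∈ S) (hcx : c < spineIndex x) :
    (∑ j ∈ Finset.univ.filter (· < spineIndex x), t j) + 1 ≤ S.card := by
  classical
  have hxA : x ∉ leavesLeft t (spineIndex x) := by
    rcases x with x | x
    · exact inl_notMem_leavesLeft
    · simp [inr_mem_leavesLeft]
  rw [← card_leavesLeft, ← Finset.card_insert_of_notMem hxA]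
  refine Finset.card_le_card (Finset.insert_subset hx fun z hz => ?_)
  rcases z with m | z
  · exact absurd hz inl_notMem_leavesLeft
  rw [inr_mem_leavesLeft] at hz
  have hright : ∀ l, Sum.inl l ∈ S → spineIndex x ≤ l := by
    intro l hl
    by_contra! hlt
    exact hS l hl _ hy _ hx (by simp) (by rintro rfl; simp at hlt)
      (by rintro rfl; simp at hcx) (hc l) hlt.le
  by_contra hzS
  refine hmax _ hzS ?_
  intro l hl a ha b hb hal hbl hab h1 h2
  have hl : Sum.inl l ∈ S := by simpa using hl
  have hxl := hright l hl
  rcases ha with rfl | ha <;> rcases hb with rfl | hb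
  · exact hab rfl
  · refine hS l hl _ hy b hb (by simp) hbl ?_ (hc l) h2
    rintro rfl
    exact absurd (hcx.trans_le (hxl.trans h2)) (lt_irrefl _)
  · exact absurd (hz.trans_le (hxl.trans h2)) (lt_irrefl _)
  · exact hS l hl a ha b hb hal hbl hab h1 h2

end Caterpillar

section Distance

variable {k : ℕ} {t : Fin k → ℕ}

/-- `1` for a leaf and `0` for a vertex of the central path. -/
def leafHeight : (Fin k ⊕ Σ i : Fin k, Fin (t i)) → ℕ :=
  Sum.elim (fun _ => 0) fun _ => 1

@[simp] lemma leafHeight_inl (i : Fin k) :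
    leafHeight (Sum.inl i : Fin k ⊕ Σ i : Fin k, Fin (t i)) = 0 := rfl

@[simp] lemma leafHeight_inr (a : Σ i : Fin k, Fin (t i)) :
    leafHeight (Sum.inr a : Fin k ⊕ Σ i : Fin k, Fin (t i)) = 1 := rfl

lemma Tmodel_adj_inl_inl {i j : Fin k} :
    (Tmodel k t).Adj (Sum.inl i) (Sum.inl j) ↔ (j : ℕ) = i + 1 ∨ (i : ℕ) = j + 1 := by
  simp only [Tmodel, SimpleGraph.fromRel_adj, TmodelRel, ne_eq, Sum.inl.injEq, Fin.ext_iff]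
  omega

lemma Tmodel_adj_inl_inr {i : Fin k} {a : Σ i : Fin k, Fin (t i)} :
    (Tmodel k t).Adj (Sum.inl i) (Sum.inr a) ↔ i = a.1 := by
  simp [Tmodel, SimpleGraph.fromRel_adj, TmodelRel]

lemma Tmodel_not_adj_inr_inr {a b : Σ i : Fin k, Fin (t i)} :
    ¬ (Tmodel k t).Adj (Sum.inr a) (Sum.inr b) := by
  simp [Tmodel, SimpleGraph.fromRel_adj, TmodelRel]

lemma Tmodel_walk_inl (n : ℕ) : ∀ i j : Fin k, (j : ℕ) = i + n →
    ∃ p : (Tmodel k t).Walk (Sum.inl i) (Sum.inl j), p.length = n := by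
  induction n with
  | zero =>
    intro i j h
    obtain rfl : j = i := Fin.ext h
    exact ⟨Walk.nil, rfl⟩
  | succ n ih =>
    intro i j h
    obtain ⟨p, hp⟩ := ih ⟨i + 1, by omega⟩ j (by simp only; omega)
    exact ⟨Walk.cons (Tmodel_adj_inl_inl.2 (Or.inl rfl)) p, by simp [hp]⟩

lemma Tmodel_walk_inl_dist (i j : Fin k) :
    ∃ p : (Tmodel k t).Walk (Sum.inl i) (Sum.inl j), p.length = Nat.dist i j := by
  rcases le_total (i : ℕ) j with h | h
  · obtain ⟨p, hp⟩ := Tmodel_walk_inl (t := t) (j - i) i j (by omega)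
    exact ⟨p, by rw [hp, Nat.dist_eq_sub_of_le h]⟩
  · obtain ⟨p, hp⟩ := Tmodel_walk_inl (t := t) (i - j) j i (by omega)
    exact ⟨p.reverse, by rw [Walk.length_reverse, hp, Nat.dist_eq_sub_of_le_right h]⟩

lemma Tmodel_walk_to_spine (a : Fin k ⊕ Σ i : Fin k, Fin (t i)) :
    ∃ p : (Tmodel k t).Walk a (Sum.inl (spineIndex a)), p.length = leafHeight a := by
  rcases a with i | a
  · exact ⟨Walk.nil, rfl⟩
  · exact ⟨Walk.cons (Tmodel_adj_inl_inr.2 rfl).symm Walk.nil, rfl⟩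

lemma Tmodel_exists_walk (a b : Fin k ⊕ Σ i : Fin k, Fin (t i)) :
    ∃ p : (Tmodel k t).Walk a b,
      p.length = leafHeight a + Nat.dist (spineIndex a).val (spineIndex b).val + leafHeight b := by
  obtain ⟨p, hp⟩ := Tmodel_walk_to_spine a
  obtain ⟨q, hq⟩ := Tmodel_walk_to_spine b
  obtain ⟨r, hr⟩ := Tmodel_walk_inl_dist (t := t) (spineIndex a) (spineIndex b)
  exact ⟨(p.append r).append q.reverse, by simp [hp, hq, hr]⟩

lemma Tmodel_le_walk_length {a b : Fin k ⊕ Σ i : Fin k, Fin (t i)} (p : (Tmodel k t).Walk a b)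
    (hab : a ≠ b) :
    leafHeight a + Nat.dist (spineIndex a).val (spineIndex b).val + leafHeight b ≤ p.length := by
  induction p with
  | nil => exact absurd rfl hab
  | @cons a m b h p ih =>
    rw [Walk.length_cons]
    by_cases hmb : m = b
    · subst hmb
      rcases a with i | a <;> rcases m with j | m
      · have := Tmodel_adj_inl_inl.1 h
        simp only [leafHeight_inl, spineIndex_inl, Nat.dist]
        omega
      · have := Tmodel_adj_inl_inr.1 h
        simp [this]
      · have := Tmodel_adj_inl_inr.1 h.symm
        simp [this]
      · exact absurd h Tmodel_not_adj_inr_inr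
    · specialize ih hmb
      rcases a with i | a <;> rcases m with j | m
      · have := Tmodel_adj_inl_inl.1 h
        simp only [leafHeight_inl, spineIndex_inl, Nat.dist] at ih ⊢
        omega
      · have := Tmodel_adj_inl_inr.1 h
        simp only [leafHeight_inl, leafHeight_inr, spineIndex_inl, spineIndex_inr, this] at ih ⊢
        omega
      · have := Tmodel_adj_inl_inr.1 h.symm
        simp only [leafHeight_inl, leafHeight_inr, spineIndex_inl, spineIndex_inr, this] at ih ⊢
        omega
      · exact absurd h Tmodel_not_adj_inr_inr

lemma Tmodel_connected (hk : 0 < k) : (Tmodel k t).Connected :=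
  (connected_iff _).2 ⟨fun a b => ⟨(Tmodel_exists_walk a b).choose⟩, ⟨Sum.inl ⟨0, hk⟩⟩⟩

lemma Tmodel_dist {a b : Fin k ⊕ Σ i : Fin k, Fin (t i)} (hab : a ≠ b) :
    (Tmodel k t).dist a b =
      leafHeight a + Nat.dist (spineIndex a).val (spineIndex b).val + leafHeight b := by
  obtain ⟨p, hp⟩ := Tmodel_exists_walk a b
  obtain ⟨q, hq⟩ := p.reachable.exists_walk_length_eq_dist
  exact le_antisymm (hp ▸ dist_le p) (hq ▸ Tmodel_le_walk_length q hab)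

lemma isGPSet_Tmodel_iff (hk : 0 < k) (S : Set (Fin k ⊕ Σ i : Fin k, Fin (t i))) :
    IsGPSet (Tmodel k t) S ↔ SpineFree S := by
  rw [isGPSet_iff_dist (Tmodel_connected hk)]
  constructor
  · intro h l hl a ha b hb hal hbl hab h1 h2
    refine h a ha _ hl b hb hal hbl.symm hab ?_
    rw [Tmodel_dist hal, Tmodel_dist hbl.symm, Tmodel_dist hab]
    rw [Fin.le_def] at h1 h2
    simp only [leafHeight_inl, spineIndex_inl, Nat.dist]
    omega
  · intro h a ha m hm b hb ham hmb hab hd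
    rw [Tmodel_dist ham, Tmodel_dist hmb, Tmodel_dist hab] at hd
    rcases m with l | m
    · simp only [leafHeight_inl, spineIndex_inl, Nat.dist] at hd
      have hcases : (spineIndex a ≤ l ∧ l ≤ spineIndex b) ∨
          (spineIndex b ≤ l ∧ l ≤ spineIndex a) := by
        simp only [Fin.le_def]
        omega
      rcases hcases with ⟨h1, h2⟩ | ⟨h1, h2⟩
      · exact h l hm a ha b hb ham hmb.symm hab h1 h2
      · exact h l hm b hb a ha hmb.symm ham hab.symm h1 h2
    · simp only [leafHeight_inr, spineIndex_inr, Nat.dist] at hd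
      omega

end Distance

/-- For `k ≥ 2`, `t₁ ≥ 1`, `t_k ≥ 1`,
`gpg'(T_{t₁,…,t_k}) = min_{i ∈ [k]} max{t₁ + ⋯ + t_{i-1}, t_{i+1} + ⋯ + t_k} + 1`. -/
theorem stmt_17 (k : ℕ) (hk : 2 ≤ k) (t : Fin k → ℕ)
    (h1 : 1 ≤ t ⟨0, by omega⟩) (hklast : 1 ≤ t ⟨k - 1, by omega⟩) :
    gpg' (Tmodel k t) =
      Finset.univ.inf' ⟨⟨0, by omega⟩, Finset.mem_univ _⟩
        (fun i : Fin k =>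
          max (∑ j ∈ Finset.univ.filter fun j => j < i, t j)
              (∑ j ∈ Finset.univ.filter fun j => i < j, t j)) + 1 := by
  classical
  have hk0 : 0 < k := by omega
  have hbot : ∀ j : Fin k, (⟨0, by omega⟩ : Fin k) ≤ j := fun j => Nat.zero_le _
  have htop : ∀ j : Fin k, j ≤ (⟨k - 1, by omega⟩ : Fin k) := fun j => by
    rw [Fin.le_def]; simp only; omega
  have hL : ∀ i : Fin k, (⟨0, by omega⟩ : Fin k) < i →
      1 ≤ ∑ j ∈ Finset.univ.filter fun j => j < i, t j := fun i hi =>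
    h1.trans (Finset.single_le_sum (f := t) (fun _ _ => Nat.zero_le _) (by simpa using hi))
  have hR : ∀ i : Fin k, i < (⟨k - 1, by omega⟩ : Fin k) →
      1 ≤ ∑ j ∈ Finset.univ.filter fun j => i < j, t j := fun i hi =>
    hklast.trans (Finset.single_le_sum (f := t) (fun _ _ => Nat.zero_le _) (by simpa using hi))
  have hpos : ∀ i : Fin k, (⟨0, by omega⟩ : Fin k) < i ∨ i < (⟨k - 1, by omega⟩ : Fin k) := by
    intro i
    simp only [Fin.lt_def]
    omega
  apply le_antisymm
  · obtain ⟨i, -, hi⟩ := Finset.exists_mem_eq_inf' (s := Finset.univ)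
      ⟨⟨0, by omega⟩, Finset.mem_univ _⟩ (fun i : Fin k =>
          max (∑ j ∈ Finset.univ.filter fun j => j < i, t j)
              (∑ j ∈ Finset.univ.filter fun j => i < j, t j))
    rw [hi]
    refine gpg'_le (Sum.inl i) fun S hiS hgp => ?_
    rw [isGPSet_Tmodel_iff hk0] at hgp
    by_cases hl : ∃ a ∈ S, spineIndex a < i
    · obtain ⟨a, ha, hai⟩ := hl
      exact (card_le_of_left hgp hbot h1 hiS ha hai).trans
        (Nat.add_le_add_right (le_max_left _ _) 1)
    by_cases hr : ∃ a ∈ S, i < spineIndex a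
    · obtain ⟨a, ha, hai⟩ := hr
      exact (card_le_of_left (α := (Fin k)ᵒᵈ) (t := t) hgp.dual htop hklast hiS ha hai).trans
        (Nat.add_le_add_right (le_max_right _ _) 1)
    push Not at hl hr
    rw [← Finset.card_erase_add_one hiS, Nat.add_le_add_iff_right]
    refine le_trans (b := 1) (Finset.card_le_one.2 fun a ha b hb => ?_) ?_
    · by_contra hab
      rw [Finset.mem_erase] at ha hb
      exact hgp i hiS a ha.2 b hb.2 ha.1 hb.1 hab (hr a ha.2) (hl b hb.2)
    · exact (hpos i).elim (fun h => (hL i h).trans (le_max_left _ _))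
        fun h => (hR i h).trans (le_max_right _ _)
  · have : Nontrivial (Fin k ⊕ Σ i : Fin k, Fin (t i)) :=
      ⟨Sum.inl ⟨0, hk0⟩, Sum.inr ⟨⟨0, hk0⟩, ⟨0, h1⟩⟩, by simp⟩
    refine le_gpg' fun x => ?_
    have hinf := Finset.inf'_le (fun i : Fin k =>
          max (∑ j ∈ Finset.univ.filter fun j => j < i, t j)
              (∑ j ∈ Finset.univ.filter fun j => i < j, t j)) (Finset.mem_univ (spineIndex x))
    rcases le_total (∑ j ∈ Finset.univ.filter fun j => spineIndex x < j, t j)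
      (∑ j ∈ Finset.univ.filter fun j => j < spineIndex x, t j) with h | h
    · have hcx : (⟨0, by omega⟩ : Fin k) < spineIndex x := by
        by_contra hcx
        have h2 := (hpos (spineIndex x)).resolve_left hcx
        have h3 := (hR _ h2).trans h
        rw [Finset.filter_false_of_mem fun j _ => by
          rw [not_lt] at hcx ⊢; exact hcx.trans (hbot j)] at h3
        simp at h3
      refine ⟨Sum.inr ⟨⟨0, by omega⟩, ⟨0, h1⟩⟩, ?_, fun S hx hy hS hmax => ?_⟩
      · rintro rfl
        exact lt_irrefl _ hcx
      simp only [isGPSet_Tmodel_iff hk0] at hS hmax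
      rw [max_eq_left h] at hinf
      exact (Nat.add_le_add_right hinf 1).trans
        (card_ge_of_maximal hS hmax hbot ⟨0, h1⟩ hx hy hcx)
    · have hcx : spineIndex x < (⟨k - 1, by omega⟩ : Fin k) := by
        by_contra hcx
        have h2 := (hpos (spineIndex x)).resolve_right hcx
        have h3 := (hL _ h2).trans h
        rw [Finset.filter_false_of_mem fun j _ => by
          rw [not_lt] at hcx ⊢; exact (htop j).trans hcx] at h3
        simp at h3
      refine ⟨Sum.inr ⟨⟨k - 1, by omega⟩, ⟨0, hklast⟩⟩, ?_, fun S hx hy hS hmax => ?_⟩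
      · intro hx
        rw [← hx] at hcx
        exact lt_irrefl _ hcx
      simp only [isGPSet_Tmodel_iff hk0] at hS hmax
      rw [max_eq_right h] at hinf
      exact (Nat.add_le_add_right hinf 1).trans
        (card_ge_of_maximal (α := (Fin k)ᵒᵈ) (t := t) hS.dual
          (fun v hv hv' => hmax v hv hv'.dual) htop ⟨0, hklast⟩ hx hy hcx)
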